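/- Let τ ∈ (0,1), let n be a positive natural number, and let a, b : Fin n → ℝ. Then the map c ↦ −∑_{i=1}^n b_i · ψ_τ(a_i − b_i c) is monotone nondecreasing on ℝ. (This is the directional-monotonicity property, condition C3* in the proof of Theorem 1, expressing that the subgradient of the convex function c ↦ ∑_i φ_τ(a_i − b_i c) is nondecreasing.) -/

import Mathlib

/-- The quantile score function `ψ_τ`. -/
noncomputable def quantileScore (τ : ℝ) (c : ℝ) : ℝ := if c < 0 then τ - 1 else τ

/-- The quantile score is nondecreasing. -/
theorem quantileScore_monotone (τ : ℝ) : Monotone (quantileScore τ) := by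
  intro x y hxy
  unfold quantileScore
  split_ifs <;> linarith

/-- Each summand `c ↦ b · ψ_τ(a − b · c)` is nonincreasing, whatever the sign of `b`. -/
theorem mul_quantileScore_antitone (τ a b : ℝ) :
    Antitone (fun c : ℝ => b * quantileScore τ (a - b * c)) := by
  intro x y hxy
  rcases le_total 0 b with hb | hb
  · exact mul_le_mul_of_nonneg_left
      (quantileScore_monotone τ (sub_le_sub_left (mul_le_mul_of_nonneg_left hxy hb) a)) hb
  · exact mul_le_mul_of_nonpos_left
      (quantileScore_monotone τ (sub_le_sub_left (mul_le_mul_of_nonpos_left hxy hb) a)) hb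

/-- Directional monotonicity (condition C3* in the proof of Theorem 1): for `τ ∈ (0,1)`
and vectors `a, b : Fin n → ℝ`, the map `c ↦ −∑ i, b i · ψ_τ(a i − b i · c)` is
monotone nondecreasing on `ℝ`. -/
theorem neg_sum_mul_quantileScore_monotone (τ : ℝ) (hτ : τ ∈ Set.Ioo (0 : ℝ) 1)
    (n : ℕ) (hn : 0 < n) (a b : Fin n → ℝ) :
    Monotone (fun c : ℝ => -∑ i : Fin n, b i * quantileScore τ (a i - b i * c)) := by
  intro x y hxy
  exact neg_le_neg (Finset.sum_le_sum fun i _ => mul_quantileScore_antitone τ (a i) (b i) hxy)
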